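/- Let n ≥ 2 and m = 2n − 1, identify the vertices of the m-gon with ZMod m, and for a ∈ ZMod m let W(a) = {a + 1, a + 2, …, a + (n−1)} ⊆ ZMod m. Fix distinct u, v ∈ ZMod m. Then the map ρ : ZMod m → ZMod m defined by ρ(a) = u + v − n − a is an involution of ZMod m which maps the set {a ∈ ZMod m : u ∈ W(a) and v ∉ W(a)} bijectively onto the set {a ∈ ZMod m : v ∈ W(a) and u ∉ W(a)}. -/

import Mathlib

/-- The open arc of `n - 1` consecutive vertices following `a` on the `(2n-1)`-gon,
whose vertices are identified with `ZMod (2n-1)`. -/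
def arcSide (n : ℕ) (a : ZMod (2 * n - 1)) : Set (ZMod (2 * n - 1)) :=
  {x | ∃ k : ℕ, 1 ≤ k ∧ k ≤ n - 1 ∧ x = a + (k : ZMod (2 * n - 1))}

/-- A vertex lies on the side of the reflected arc iff its mirror image lies on the side of
the original arc. -/
theorem left_mem_arcSide_reflection_iff {n : ℕ} (x y a : ZMod (2 * n - 1)) :
    x ∈ arcSide n (x + y - (n : ZMod (2 * n - 1)) - a) ↔ y ∈ arcSide n a := by
  constructor
  · rintro ⟨k, hk, hkn, h⟩
    refine ⟨n - k, by omega, by omega, ?_⟩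
    rw [Nat.cast_sub (by omega)]
    linear_combination -h
  · rintro ⟨k, hk, hkn, h⟩
    refine ⟨n - k, by omega, by omega, ?_⟩
    rw [Nat.cast_sub (by omega)]
    linear_combination -h

theorem right_mem_arcSide_reflection_iff {n : ℕ} (x y a : ZMod (2 * n - 1)) :
    y ∈ arcSide n (x + y - (n : ZMod (2 * n - 1)) - a) ↔ x ∈ arcSide n a := by
  rw [add_comm x y, left_mem_arcSide_reflection_iff]

/-- The reflection of the `(2n-1)`-gon exchanging `u` and `v` acts on arc
parameters by `a ↦ u + v - n - a`; this is an involution carrying the arcs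
whose `(n-1)`-side contains `u` but not `v` bijectively onto those whose
`(n-1)`-side contains `v` but not `u`. -/
theorem reflection_involutive_and_bijOn_arcs
    (n : ℕ) (hn : 2 ≤ n) (u v : ZMod (2 * n - 1)) (huv : u ≠ v) :
    Function.Involutive
        (fun a : ZMod (2 * n - 1) => u + v - (n : ZMod (2 * n - 1)) - a) ∧
      Set.BijOn (fun a : ZMod (2 * n - 1) => u + v - (n : ZMod (2 * n - 1)) - a)
        {a : ZMod (2 * n - 1) | u ∈ arcSide n a ∧ v ∉ arcSide n a}
        {a : ZMod (2 * n - 1) | v ∈ arcSide n a ∧ u ∉ arcSide n a} := by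
  have hinv : Function.Involutive
      (fun a : ZMod (2 * n - 1) => u + v - (n : ZMod (2 * n - 1)) - a) :=
    fun a => sub_sub_cancel _ a
  refine ⟨hinv, fun a ha => ?_, hinv.injective.injOn, fun a ha => ⟨_, ?_, hinv a⟩⟩
  · simpa only [Set.mem_ofPred_eq, left_mem_arcSide_reflection_iff,
      right_mem_arcSide_reflection_iff] using ha
  · simpa only [Set.mem_ofPred_eq, left_mem_arcSide_reflection_iff,
      right_mem_arcSide_reflection_iff] using ha
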